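/- arXiv:1601.01478 — 7 statements merged into one kernel-verified Lean document; each statement's English description precedes it below -/
import Mathlib

section
/- Let K=(S,AP,→,L) be a Kripke structure and let π be a partition of S that is stable and that refines the initial partition π₀ (i.e., any two states in the same block of π have the same label). Then for all states s,t ∈ S lying in the same block of π, s and t are divergence-blind stuttering equivalent, s ≈_dbs t. -/
/-- A Kripke structure: states, atomic propositions, a total transition
relation and a state labelling. -/
structure Kripke (S AP : Type*) where
  tr : S → S → Prop
  L : S → Set AP
  total : ∀ s : S, ∃ t : S, tr s t

variable {S AP : Type*}

/-- `R` is a divergence-blind stuttering equivalence. -/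
def IsDBS (K : Kripke S AP) (R : S → S → Prop) : Prop :=
  Symmetric R ∧ ∀ s t, R s t →
    K.L s = K.L t ∧
    ∀ s', K.tr s s' → ∃ (k : ℕ) (f : ℕ → S), f 0 = t ∧
      (∀ i < k, K.tr (f i) (f (i + 1))) ∧
      (∀ i < k, R s (f i)) ∧ R s' (f k)

/-- Divergence-blind stuttering equivalence of two states. -/
def DBSEq (K : Kripke S AP) (s t : S) : Prop :=
  ∃ R, IsDBS K R ∧ R s t

/-- `π` is a partition of the set of all states. -/
def IsPartition (π : Set (Set S)) : Prop :=
  (∀ B ∈ π, B.Nonempty) ∧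
  (∀ B ∈ π, ∀ B' ∈ π, B ≠ B' → B ∩ B' = ∅) ∧
  ⋃₀ π = Set.univ

/-- `split C Bu`: the states in `C` from which a path inside `C` reaches `Bu`. -/
def split (K : Kripke S AP) (C Bu : Set S) : Set S :=
  {s ∈ C | ∃ (k : ℕ) (f : ℕ → S), f 0 = s ∧
    (∀ i < k, K.tr (f i) (f (i + 1))) ∧ (∀ i < k, f i ∈ C) ∧ f k ∈ Bu}

def cosplit (K : Kripke S AP) (C Bu : Set S) : Set S :=
  C \ split K C Bu

/-- A block `C` is unstable under `Bu` iff both `split` and `cosplit` are nonempty. -/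
def Unstable (K : Kripke S AP) (C Bu : Set S) : Prop :=
  (split K C Bu).Nonempty ∧ (cosplit K C Bu).Nonempty

/-- The bottom states of a block: no outgoing transition inside the block. -/
def bottom (K : Kripke S AP) (B : Set S) : Set S :=
  {s ∈ B | ∀ s' ∈ B, ¬ K.tr s s'}

/-- A partition is cycle-free: no block contains a cycle staying inside it. -/
def CycleFree (K : Kripke S AP) (π : Set (Set S)) : Prop :=
  ¬ ∃ B ∈ π, ∃ (k : ℕ) (f : ℕ → S),
    (∀ i ≤ k, f i ∈ B) ∧ (∀ i < k, K.tr (f i) (f (i + 1))) ∧ K.tr (f k) (f 0)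

/-- `π` respects divergence-blind stuttering equivalence. -/
def Respects (K : Kripke S AP) (π : Set (Set S)) : Prop :=
  ∀ s t, DBSEq K s t → ∃ B ∈ π, s ∈ B ∧ t ∈ B

/-- The refinement of `π` under `Bu`: every unstable block is replaced by
its `split` and `cosplit` parts. -/
def refinement (K : Kripke S AP) (π : Set (Set S)) (Bu : Set S) : Set (Set S) :=
  {B ∈ π | ¬ Unstable K B Bu} ∪
  {C | ∃ B' ∈ π, Unstable K B' Bu ∧ (C = split K B' Bu ∨ C = cosplit K B' Bu)}

theorem mem_split_of_tr {K : Kripke S AP} {C D : Set S} {s s' : S} (hs : s ∈ C)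
    (hs' : s' ∈ D) (htr : K.tr s s') : s ∈ split K C D := by
  refine ⟨hs, 1, fun i => if i = 0 then s else s', rfl, fun i hi => ?_, fun i hi => ?_, hs'⟩
  all_goals
    obtain rfl : i = 0 := by omega
    simpa

theorem mem_split_of_not_unstable {K : Kripke S AP} {C D : Set S} {s t : S}
    (h : ¬ Unstable K C D) (hs : s ∈ split K C D) (ht : t ∈ C) : t ∈ split K C D := by
  by_contra hn
  exact h ⟨⟨s, hs⟩, t, ht, hn⟩

/-- If `π` is a stable partition refining the initial partition (states in a
common block have equal labels), then states in a common block of `π` are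
divergence-blind stuttering equivalent. -/
theorem stable_partition_implies_dbs [Fintype S] [Fintype AP]
    (K : Kripke S AP) (π : Set (Set S))
    (hpart : IsPartition π)
    (hstable : ∀ σ ⊆ π, ∀ B' ∈ π, ¬ Unstable K B' (⋃₀ σ))
    (hrefine : ∀ B ∈ π, ∀ s ∈ B, ∀ t ∈ B, K.L s = K.L t) :
    ∀ B ∈ π, ∀ s ∈ B, ∀ t ∈ B, DBSEq K s t := by
  intro B hB s hs t ht
  refine ⟨fun x y => ∃ C ∈ π, x ∈ C ∧ y ∈ C, ⟨?_, ?_⟩, B, hB, hs, ht⟩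
  · rintro x y ⟨C, hC, hx, hy⟩
    exact ⟨C, hC, hy, hx⟩
  · rintro x y ⟨C, hC, hx, hy⟩
    refine ⟨hrefine C hC x hx y hy, fun x' htr => ?_⟩
    obtain ⟨D, hD, hx'⟩ : x' ∈ ⋃₀ π := hpart.2.2 ▸ Set.mem_univ x'
    have hst := hstable {D} (Set.singleton_subset_iff.2 hD) C hC
    rw [Set.sUnion_singleton] at hst
    obtain ⟨-, k, f, h0, hf, hfC, hfD⟩ :=
      mem_split_of_not_unstable hst (mem_split_of_tr hx hx' htr) hy
    exact ⟨k, f, h0, hf, fun i hi => ⟨C, hC, hx, hfC i hi⟩, D, hD, hx', hfD⟩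
end

section
/- Let K=(S,AP,→,L) be a Kripke structure, π a partition of S that respects divergence-blind stuttering equivalence, and 𝐁 a union of some of the blocks of π. Then the refinement of π under 𝐁 also respects divergence-blind stuttering equivalence. -/
variable {S AP : Type*}

/-- Some path starting at `s` reaches `D`, all of its states before the last lying in `C`. -/
def ReachesThrough (K : Kripke S AP) (C D : Set S) (s : S) : Prop :=
  ∃ (k : ℕ) (f : ℕ → S), f 0 = s ∧
    (∀ i < k, K.tr (f i) (f (i + 1))) ∧ (∀ i < k, f i ∈ C) ∧ f k ∈ D

theorem ReachesThrough.cons {K : Kripke S AP} {C D : Set S} {s s' : S} (hs : s ∈ C)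
    (htr : K.tr s s') (h : ReachesThrough K C D s') : ReachesThrough K C D s := by
  obtain ⟨k, f, rfl, hf, hC, hD⟩ := h
  refine ⟨k + 1, fun n => Nat.casesOn n s f, rfl, ?_, ?_, hD⟩
  · rintro (_ | i) hi
    · exact htr
    · exact hf i (by omega)
  · rintro (_ | i) hi
    · exact hs
    · exact hC i (by omega)

theorem ReachesThrough.of_path {K : Kripke S AP} {C D : Set S} (k : ℕ) (f : ℕ → S)
    (hf : ∀ i < k, K.tr (f i) (f (i + 1))) (hC : ∀ i < k, f i ∈ C)
    (h : ReachesThrough K C D (f k)) : ReachesThrough K C D (f 0) := by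
  induction k with
  | zero => exact h
  | succ k ih =>
    exact ih (fun i hi => hf i (by omega)) (fun i hi => hC i (by omega))
      (h.cons (hC k (by omega)) (hf k (by omega)))

/-- A divergence-blind stuttering equivalence that preserves `C` and `D` also preserves
reachability of `D` through `C`. -/
theorem IsDBS.reachesThrough {K : Kripke S AP} {R : S → S → Prop} (hR : IsDBS K R)
    {C D : Set S} (hC : ∀ s t, R s t → s ∈ C → t ∈ C) (hD : ∀ s t, R s t → s ∈ D → t ∈ D)
    {s t : S} (hst : R s t) (h : ReachesThrough K C D s) : ReachesThrough K C D t := by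
  obtain ⟨k, f, rfl, hf, hfC, hfD⟩ := h
  induction k generalizing f t with
  | zero => exact ⟨0, fun _ => t, rfl, by simp, by simp, hD _ _ hst hfD⟩
  | succ k ih =>
    obtain ⟨m, g, rfl, hg, hRg, hlast⟩ := (hR.2 _ _ hst).2 _ (hf 0 (by omega))
    refine .of_path m g hg (fun i hi => hC _ _ (hRg i hi) (hfC 0 (by omega))) ?_
    exact ih (fun n => f (n + 1)) hlast (fun i hi => hf (i + 1) (by omega))
      (fun i hi => hfC (i + 1) (by omega)) hfD

theorem IsPartition.eq_of_mem {π : Set (Set S)} (hπ : IsPartition π) {B B' : Set S}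
    (hB : B ∈ π) (hB' : B' ∈ π) {s : S} (hs : s ∈ B) (hs' : s ∈ B') : B = B' := by
  by_contra hne
  have h : s ∈ B ∩ B' := ⟨hs, hs'⟩
  rw [hπ.2.1 B hB B' hB' hne] at h
  exact h

theorem Respects.mem_of_mem {K : Kripke S AP} {π : Set (Set S)} (h : Respects K π)
    (hπ : IsPartition π) {B : Set S} (hB : B ∈ π) {s t : S} (hst : DBSEq K s t)
    (hs : s ∈ B) : t ∈ B := by
  obtain ⟨B', hB', hs', ht'⟩ := h s t hst
  rwa [hπ.eq_of_mem hB hB' hs hs']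

theorem Respects.mem_split {K : Kripke S AP} {π σ : Set (Set S)} (h : Respects K π)
    (hπ : IsPartition π) (hσ : σ ⊆ π) {B : Set S} (hB : B ∈ π) {s t : S}
    (hst : DBSEq K s t) (hs : s ∈ split K B (⋃₀ σ)) : t ∈ split K B (⋃₀ σ) := by
  refine ⟨h.mem_of_mem hπ hB hst hs.1, ?_⟩
  obtain ⟨R, hR, hRst⟩ := hst
  refine hR.reachesThrough (fun a b hab => h.mem_of_mem hπ hB ⟨R, hR, hab⟩) ?_ hRst hs.2
  rintro a b hab ⟨A, hA, ha⟩
  exact ⟨A, hA, h.mem_of_mem hπ (hσ hA) ⟨R, hR, hab⟩ ha⟩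

theorem DBSEq.symm {K : Kripke S AP} {s t : S} (h : DBSEq K s t) : DBSEq K t s := by
  obtain ⟨R, hR, hst⟩ := h
  exact ⟨R, hR, hR.1 hst⟩

/-- If `π` respects divergence-blind stuttering equivalence, then so does the
refinement of `π` under a union of some of the blocks of `π`. -/
theorem refinement_respects_dbs [Fintype S] [Fintype AP]
    (K : Kripke S AP) (π : Set (Set S))
    (hpart : IsPartition π)
    (hresp : Respects K π)
    (σ : Set (Set S)) (hσ : σ ⊆ π) :
    Respects K (refinement K π (⋃₀ σ)) := by
  intro s t hst
  obtain ⟨B, hB, hs, ht⟩ := hresp s t hst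
  by_cases hU : Unstable K B (⋃₀ σ)
  · by_cases hsplit : s ∈ split K B (⋃₀ σ)
    · exact ⟨_, Or.inr ⟨B, hB, hU, Or.inl rfl⟩, hsplit,
        hresp.mem_split hpart hσ hB hst hsplit⟩
    · exact ⟨_, Or.inr ⟨B, hB, hU, Or.inr rfl⟩, ⟨hs, hsplit⟩, ht,
        fun h => hsplit (hresp.mem_split hpart hσ hB hst.symm h)⟩
  · exact ⟨B, Or.inl ⟨hB, hU⟩, hs, ht⟩
end

section
/- Let K=(S,AP,→,L) be a Kripke structure, π a cycle-free partition of S, and π' a partition refining π. Suppose π is stable under a union 𝐁 of some of the blocks of π, and a block B' ∈ π is refined into blocks B₁',…,B_k' ∈ π'. Then for each B_i' all of whose bottom states are also bottom states of B' (i.e., bottom(B_i') ⊆ bottom(B')), the block B_i' is stable under 𝐁, i.e., split(B_i',𝐁) is empty or equals B_i'. -/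
variable {S AP : Type*}

theorem mem_split_of_mem {K : Kripke S AP} {C Bu : Set S} {s : S} (hs : s ∈ C)
    (h : s ∈ Bu) : s ∈ split K C Bu :=
  ⟨hs, 0, fun _ => s, rfl, by simp, by simp, h⟩

theorem mem_split_of_tr_mem {K : Kripke S AP} {C Bu : Set S} {s t : S} (hs : s ∈ C)
    (hst : K.tr s t) (ht : t ∈ Bu) : s ∈ split K C Bu := by
  refine ⟨hs, 1, fun n => if n = 0 then s else t, by simp, ?_, ?_, by simpa using ht⟩
  · intro i hi
    obtain rfl : i = 0 := by omega
    simpa using hst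
  · intro i hi
    obtain rfl : i = 0 := by omega
    simpa using hs

theorem mem_split_of_tr_split {K : Kripke S AP} {C Bu : Set S} {s t : S} (hs : s ∈ C)
    (hst : K.tr s t) (ht : t ∈ split K C Bu) : s ∈ split K C Bu := by
  obtain ⟨-, k, f, rfl, htr, hC, hk⟩ := ht
  refine ⟨hs, k + 1, fun n => Nat.casesOn n s f, rfl, ?_, ?_, hk⟩
  · rintro (_ | i) hi
    · exact hst
    · exact htr i (by omega)
  · rintro (_ | i) hi
    · exact hs
    · exact hC i (by omega)

theorem split_mono {K : Kripke S AP} {C D Bu : Set S} (h : C ⊆ D) :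
    split K C Bu ⊆ split K D Bu := by
  rintro s ⟨hs, k, f, h0, htr, hC, hk⟩
  exact ⟨h hs, k, f, h0, htr, fun i hi => h (hC i hi), hk⟩

/-- A bottom state of `D` that reaches `Bu` through `D` does so in at most one step. -/
theorem mem_split_of_mem_bottom {K : Kripke S AP} {C D Bu : Set S} {s : S} (hs : s ∈ C)
    (hb : s ∈ bottom K D) (h : s ∈ split K D Bu) : s ∈ split K C Bu := by
  obtain ⟨-, k, f, rfl, htr, hD, hk⟩ := h
  match k with
  | 0 => exact mem_split_of_mem hs hk
  | 1 => exact mem_split_of_tr_mem hs (htr 0 (by omega)) hk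
  | k + 2 => exact absurd (htr 0 (by omega)) (hb.2 _ (hD 1 (by omega)))

/-- In a finite structure, a nonempty subset of a block of a cycle-free partition contains
a bottom state. -/
theorem CycleFree.bottom_nonempty [Finite S] {K : Kripke S AP} {π : Set (Set S)}
    (hcf : CycleFree K π) {B : Set S} (hB : B ∈ π) {C : Set S} (hCB : C ⊆ B)
    (hC : C.Nonempty) : (bottom K C).Nonempty := by
  by_contra hne
  have hsucc : ∀ x : C, ∃ y : C, K.tr x y := by
    intro x
    by_contra hx
    exact hne ⟨x, x.2, fun y hy hxy => hx ⟨⟨y, hy⟩, hxy⟩⟩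
  choose g hg using hsucc
  obtain ⟨x, hx⟩ := hC
  let f : ℕ → C := fun n => g^[n] ⟨x, hx⟩
  have hf : ∀ n, K.tr (f n) (f (n + 1)) := by
    intro n
    simp only [f, Function.iterate_succ_apply']
    exact hg _
  obtain ⟨i, j, hij, hfij⟩ : ∃ i j, i < j ∧ f i = f j := by
    obtain ⟨i, j, hne, h⟩ := Finite.exists_ne_map_eq_of_infinite f
    rcases lt_or_gt_of_ne hne with hlt | hlt
    · exact ⟨i, j, hlt, h⟩
    · exact ⟨j, i, hlt, h.symm⟩
  obtain ⟨k, rfl⟩ := Nat.exists_eq_add_of_lt hij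
  refine hcf ⟨B, hB, k, fun n => f (i + n), fun n _ => hCB (f (i + n)).2,
    fun n _ => hf (i + n), ?_⟩
  simpa [hfij] using hf (i + k)

/-- If the cycle-free partition `π` is stable under a union `⋃₀ σ` of some of
its blocks, `π'` refines `π`, and the block `B' ∈ π` is refined into blocks of
`π'`, then each such block all of whose bottom states are bottom states of `B'`
is stable under `⋃₀ σ`. -/
theorem new_bottom_states_stability [Fintype S] [Fintype AP]
    (K : Kripke S AP) (π π' : Set (Set S))
    (hpart : IsPartition π) (hpart' : IsPartition π')
    (hcf : CycleFree K π)
    (href : ∀ C ∈ π', ∃ B ∈ π, C ⊆ B)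
    (σ : Set (Set S)) (hσ : σ ⊆ π)
    (hstable : ∀ B ∈ π, ¬ Unstable K B (⋃₀ σ))
    (B' : Set S) (hB' : B' ∈ π) :
    ∀ Bi ∈ π', Bi ⊆ B' → bottom K Bi ⊆ bottom K B' →
      split K Bi (⋃₀ σ) = ∅ ∨ split K Bi (⋃₀ σ) = Bi := by
  intro Bi _ hsub hbot
  rw [or_iff_not_imp_left, ← ne_eq, ← Set.nonempty_iff_ne_empty]
  intro hne
  refine Set.Subset.antisymm (fun s hs => hs.1) ?_
  by_contra hnot
  obtain ⟨s, ⟨hsB, hs⟩, hsb⟩ := hcf.bottom_nonempty (C := cosplit K Bi (⋃₀ σ)) hB'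
    (fun s hs => hsub hs.1) (Set.sdiff_nonempty.mpr hnot)
  have hsbot : s ∈ bottom K Bi := by
    refine ⟨hsB, fun t ht hst => ?_⟩
    by_cases htsplit : t ∈ split K Bi (⋃₀ σ)
    · exact hs (mem_split_of_tr_split hsB hst htsplit)
    · exact hsb t ⟨ht, htsplit⟩ hst
  refine hs (mem_split_of_mem_bottom hsB (hbot hsbot) ?_)
  by_contra hs'
  exact hstable B' hB' ⟨hne.mono (split_mono hsub), s, hsub hsB, hs'⟩
end

section
/- Let K=(S,AP,→,L) be a Kripke structure and let s₀ → s₁ → ⋯ → s_k → s₀ (k ≥ 0) be a cycle of states such that L(s_i) = L(s_j) for all i,j ≤ k. Then all states on the cycle are pairwise divergence-blind stuttering equivalent: s_i ≈_dbs s_j for all i,j ≤ k. -/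
variable {S AP : Type*}

/-- A map with consecutive transitions up to `k` that closes up extends periodically to an
infinite path. -/
theorem Kripke.tr_mod_of_cycle {K : Kripke S AP} {k : ℕ} {f : ℕ → S}
    (htr : ∀ i < k, K.tr (f i) (f (i + 1))) (hcl : K.tr (f k) (f 0)) (n : ℕ) :
    K.tr (f (n % (k + 1))) (f ((n + 1) % (k + 1))) := by
  have hn : n % (k + 1) < k + 1 := Nat.mod_lt _ k.succ_pos
  rw [Nat.add_mod_eq_ite]
  rcases Nat.lt_succ_iff_lt_or_eq.mp hn with h | h
  · have hk : 1 % (k + 1) = 1 := Nat.mod_eq_of_lt (by omega)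
    rw [hk, if_neg (by omega)]
    exact htr _ h
  · rcases Nat.eq_zero_or_pos k with rfl | hpos
    · simpa [Nat.mod_one] using hcl
    · have hk : 1 % (k + 1) = 1 := Nat.mod_eq_of_lt (by omega)
      rw [hk, if_pos (by omega), h, Nat.sub_self]
      exact hcl

/-- If any two states of `C` have the same label and are joined by a path inside `C`, then
identifying the states of `C` is a divergence-blind stuttering equivalence. -/
theorem isDBS_of_strongly_connected {K : Kripke S AP} {C : Set S}
    (hlab : ∀ s ∈ C, ∀ t ∈ C, K.L s = K.L t)
    (hpath : ∀ s ∈ C, ∀ t ∈ C, ∃ (m : ℕ) (g : ℕ → S), g 0 = t ∧ g m = s ∧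
      (∀ i < m, K.tr (g i) (g (i + 1))) ∧ ∀ i ≤ m, g i ∈ C) :
    IsDBS K (fun s t => s = t ∨ s ∈ C ∧ t ∈ C) := by
  refine ⟨fun s t h => h.imp Eq.symm And.symm, ?_⟩
  rintro s t (rfl | ⟨hs, ht⟩)
  · refine ⟨rfl, fun s' hs' => ⟨1, fun n => if n = 0 then s else s', by simp, ?_, ?_, by simp⟩⟩
    all_goals simp [hs']
  · refine ⟨hlab s hs t ht, fun s' hs' => ?_⟩
    obtain ⟨m, g, hg0, hgm, hgtr, hgC⟩ := hpath s hs t ht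
    refine ⟨m + 1, fun n => if n ≤ m then g n else s', by simpa using hg0, ?_, ?_, by simp⟩
    · intro i hi
      have him : i ≤ m := by omega
      rcases him.lt_or_eq with h | rfl
      · simpa [him, Nat.succ_le_of_lt h] using hgtr i h
      · simpa [hgm] using hs'
    · intro i hi
      have him : i ≤ m := by omega
      simpa [him] using Or.inr ⟨hs, hgC i him⟩

/-- All states on a cycle whose states all carry the same label are pairwise
divergence-blind stuttering equivalent. -/
theorem cycle_same_label_dbs [Fintype S] [Fintype AP]
    (K : Kripke S AP) (k : ℕ) (f : ℕ → S)
    (htr : ∀ i < k, K.tr (f i) (f (i + 1)))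
    (hcl : K.tr (f k) (f 0))
    (hlab : ∀ i ≤ k, ∀ j ≤ k, K.L (f i) = K.L (f j)) :
    ∀ i ≤ k, ∀ j ≤ k, DBSEq K (f i) (f j) := by
  intro i hi j hj
  refine ⟨_, isDBS_of_strongly_connected (C := {s | ∃ n ≤ k, f n = s}) ?_ ?_,
    Or.inr ⟨⟨i, hi, rfl⟩, ⟨j, hj, rfl⟩⟩⟩
  · rintro _ ⟨a, ha, rfl⟩ _ ⟨b, hb, rfl⟩
    exact hlab a ha b hb
  · rintro _ ⟨a, ha, rfl⟩ _ ⟨b, hb, rfl⟩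
    refine ⟨a + (k + 1) - b, fun n => f ((b + n) % (k + 1)), ?_, ?_, ?_, ?_⟩
    · simp [Nat.mod_eq_of_lt (Nat.lt_succ_of_le hb)]
    · have h : b + (a + (k + 1) - b) = a + (k + 1) := by omega
      simp only [h, Nat.add_mod_right, Nat.mod_eq_of_lt (Nat.lt_succ_of_le ha)]
    · exact fun n _ => Kripke.tr_mod_of_cycle htr hcl (b + n)
    · exact fun n _ => ⟨_, Nat.le_of_lt_succ (Nat.mod_lt _ k.succ_pos), rfl⟩
end

section
/- Let K=(S,AP,→,L) be a Kripke structure. Divergence-blind stuttering equivalence ≈_dbs is an equivalence relation on S: it is reflexive, symmetric, and transitive. -/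
variable {S AP : Type*}

/-- `ReachVia r P Q x`: some `r`-path from `x` ends in `Q`, with all its earlier states in `P`. -/
inductive ReachVia (r : S → S → Prop) (P Q : S → Prop) : S → Prop
  | base {x : S} (hQ : Q x) : ReachVia r P Q x
  | step {x y : S} (hP : P x) (hr : r x y) (h : ReachVia r P Q y) : ReachVia r P Q x

namespace ReachVia

variable {r : S → S → Prop} {P P' Q Q' : S → Prop} {x : S}

theorem bind (h : ReachVia r P Q x) (hP : ∀ y, P y → P' y)
    (hQ : ∀ y, Q y → ReachVia r P' Q' y) : ReachVia r P' Q' x := by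
  induction h with
  | base h => exact hQ _ h
  | step hp hr _ ih => exact .step (hP _ hp) hr ih

theorem iff_exists_path : ReachVia r P Q x ↔
    ∃ (k : ℕ) (f : ℕ → S), f 0 = x ∧ (∀ i < k, r (f i) (f (i + 1))) ∧
      (∀ i < k, P (f i)) ∧ Q (f k) := by
  constructor
  · intro h
    induction h with
    | @base x hQ => exact ⟨0, fun _ => x, rfl, by simp, by simp, hQ⟩
    | @step x y hP hr _ ih =>
      obtain ⟨k, f, rfl, hf, hfP, hQ⟩ := ih
      refine ⟨k + 1, fun | 0 => x | i + 1 => f i, rfl, ?_, ?_, hQ⟩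
      · rintro (_ | i) hi
        · exact hr
        · exact hf i (by omega)
      · rintro (_ | i) hi
        · exact hP
        · exact hfP i (by omega)
  · rintro ⟨k, f, rfl, hf, hP, hQ⟩
    induction k generalizing f with
    | zero => exact .base hQ
    | succ k ih =>
      exact .step (hP 0 (by omega)) (hf 0 (by omega))
        (ih (fun i => f (i + 1)) (fun i hi => hf (i + 1) (by omega))
          (fun i hi => hP (i + 1) (by omega)) hQ)

end ReachVia

theorem isDBS_iff_reachVia {K : Kripke S AP} {R : S → S → Prop} :
    IsDBS K R ↔ Symmetric R ∧ ∀ s t, R s t → K.L s = K.L t ∧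
      ∀ s', K.tr s s' → ReachVia K.tr (R s) (R s') t := by
  simp only [IsDBS, ReachVia.iff_exists_path]

/-- The union of all divergence-blind stuttering equivalences is one itself. -/
theorem isDBS_dbsEq (K : Kripke S AP) : IsDBS K (DBSEq K) := by
  refine isDBS_iff_reachVia.2 ⟨fun s t ⟨R, hR, h⟩ => ⟨R, hR, hR.1 h⟩, ?_⟩
  rintro s t ⟨R, hR, h⟩
  obtain ⟨hL, hs⟩ := (isDBS_iff_reachVia.1 hR).2 s t h
  exact ⟨hL, fun s' hs' => (hs s' hs').bind (fun _ hy => ⟨R, hR, hy⟩)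
    fun _ hy => .base ⟨R, hR, hy⟩⟩

/-- Related states reach the same relation-closed targets through relation-closed sets. -/
theorem IsDBS.reachVia {K : Kripke S AP} {R : S → S → Prop} (hR : IsDBS K R)
    {P Q : S → Prop} (hP : ∀ x y, R x y → P x → P y) (hQ : ∀ x y, R x y → Q x → Q y)
    {u t : S} (hu : ReachVia K.tr P Q u) (h : R u t) : ReachVia K.tr P Q t := by
  induction hu generalizing t with
  | base hq => exact .base (hQ _ _ h hq)
  | step hp hr _ ih =>
    exact (((isDBS_iff_reachVia.1 hR).2 _ _ h).2 _ hr).bind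
      (fun _ hy => hP _ _ hy hp) fun _ hy => ih hy

theorem IsDBS.reflTransGen {K : Kripke S AP} {R : S → S → Prop} (hR : IsDBS K R) :
    IsDBS K (Relation.ReflTransGen R) := by
  refine isDBS_iff_reachVia.2 ⟨fun s t h => ?_, fun s t h => ?_⟩
  · induction h with
    | refl => exact .refl
    | tail _ h ih => exact .head (hR.1 h) ih
  · induction h with
    | refl => exact ⟨rfl, fun s' hs' => .step .refl hs' (.base .refl)⟩
    | tail _ h ih =>
      exact ⟨ih.1.trans (hR.2 _ _ h).1, fun s' hs' =>
        hR.reachVia (fun _ _ hxy hx => hx.tail hxy) (fun _ _ hxy hx => hx.tail hxy)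
          (ih.2 s' hs') h⟩

/-- Divergence-blind stuttering equivalence is an equivalence relation. -/
theorem dbs_equivalence [Fintype S] [Fintype AP] (K : Kripke S AP) :
    Equivalence (DBSEq K) := by
  have hT := (isDBS_dbsEq K).reflTransGen
  exact ⟨fun s => ⟨_, hT, .refl⟩, fun h => (isDBS_dbsEq K).1 h,
    fun h₁ h₂ => ⟨_, hT, .tail (.single h₁) h₂⟩⟩
end

section
/- Let A=(S,Act,→) be a labelled transition system. Branching bisimilarity is an equivalence relation on S: it is reflexive, symmetric, and transitive. -/
/-- A labelled transition system. -/
structure LTS (S Act : Type*) where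
  tr : S → Act → S → Prop

variable {S Act : Type*}

/-- `R` is a branching bisimulation relation on the LTS `A` with internal action `τ`. -/
def IsBranchingBisim (A : LTS S Act) (τ : Act) (R : S → S → Prop) : Prop :=
  Symmetric R ∧ ∀ s t, R s t → ∀ a s', A.tr s a s' →
    ((a = τ ∧ R s' t) ∨
     ∃ (k : ℕ) (f : ℕ → S), f 0 = t ∧
       (∀ i < k, A.tr (f i) τ (f (i + 1))) ∧
       R s (f k) ∧ ∃ t'', A.tr (f k) a t'' ∧ R s' t'')

/-- Branching bisimilarity of two states. -/
def BranchingBisimilar (A : LTS S Act) (τ : Act) (s t : S) : Prop :=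
  ∃ R, IsBranchingBisim A τ R ∧ R s t

/-- Finite sequences of internal steps. -/
abbrev TauReach (A : LTS S Act) (τ : Act) : S → S → Prop :=
  Relation.ReflTransGen fun s t => A.tr s τ t

/-- The transfer condition of semi-branching bisimulations: an internal step of `s` may also be
answered by internal steps leading to a state related to both its source and its target. -/
def SemiTransfer (A : LTS S Act) (τ : Act) (R : S → S → Prop) (s t : S) : Prop :=
  ∀ a s', A.tr s a s' → ∃ t', TauReach A τ t t' ∧ R s t' ∧
    ((a = τ ∧ R s' t') ∨ ∃ t'', A.tr t' a t'' ∧ R s' t'')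

/-- Symmetric relations all of whose pairs satisfy the semi-branching transfer condition. -/
def IsSemiBisim (A : LTS S Act) (τ : Act) (R : S → S → Prop) : Prop :=
  (∀ s t, R s t → R t s) ∧ ∀ s t, R s t → SemiTransfer A τ R s t

/-- Semi-branching bisimilarity. -/
def SemiBisimilar (A : LTS S Act) (τ : Act) (s t : S) : Prop :=
  ∃ R, IsSemiBisim A τ R ∧ R s t

theorem SemiTransfer.mono {A : LTS S Act} {τ : Act} {R R' : S → S → Prop} {s t : S}
    (h : SemiTransfer A τ R s t) (hR : ∀ x y, R x y → R' x y) : SemiTransfer A τ R' s t := by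
  intro a s' hs
  obtain ⟨t', ht, hst, h' | ⟨t'', htr, h'⟩⟩ := h a s' hs
  · exact ⟨t', ht, hR _ _ hst, Or.inl ⟨h'.1, hR _ _ h'.2⟩⟩
  · exact ⟨t', ht, hR _ _ hst, Or.inr ⟨t'', htr, hR _ _ h'⟩⟩

theorem isSemiBisim_semiBisimilar (A : LTS S Act) (τ : Act) :
    IsSemiBisim A τ (SemiBisimilar A τ) := by
  constructor
  · rintro s t ⟨R, hR, h⟩
    exact ⟨R, hR, hR.1 _ _ h⟩
  · rintro s t ⟨R, hR, h⟩
    exact (hR.2 s t h).mono fun x y hxy => ⟨R, hR, hxy⟩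

theorem SemiBisimilar.refl (A : LTS S Act) (τ : Act) (s : S) : SemiBisimilar A τ s s := by
  refine ⟨Eq, ⟨fun _ _ => Eq.symm, ?_⟩, rfl⟩
  rintro s _ rfl a s' h
  exact ⟨s, .refl, rfl, Or.inr ⟨s', h, rfl⟩⟩

theorem SemiBisimilar.symm {A : LTS S Act} {τ : Act} {s t : S} (h : SemiBisimilar A τ s t) :
    SemiBisimilar A τ t s :=
  (isSemiBisim_semiBisimilar A τ).1 _ _ h

theorem IsSemiBisim.exists_tauReach {A : LTS S Act} {τ : Act} {R : S → S → Prop}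
    (hR : IsSemiBisim A τ R) {s s' t : S} (h : R s t) (hs : TauReach A τ s s') :
    ∃ t', TauReach A τ t t' ∧ R s' t' := by
  induction hs with
  | refl => exact ⟨t, .refl, h⟩
  | tail _ hstep ih =>
    obtain ⟨t₁, ht₁, h₁⟩ := ih
    obtain ⟨t', ht', _, ⟨_, h'⟩ | ⟨t'', htr, h'⟩⟩ := hR.2 _ _ h₁ _ _ hstep
    · exact ⟨t', ht₁.trans ht', h'⟩
    · exact ⟨t'', (ht₁.trans ht').tail htr, h'⟩

theorem SemiBisimilar.trans {A : LTS S Act} {τ : Act} {s u t : S}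
    (hsu : SemiBisimilar A τ s u) (hut : SemiBisimilar A τ u t) : SemiBisimilar A τ s t := by
  have hB := isSemiBisim_semiBisimilar A τ
  refine ⟨fun x z => ∃ y, SemiBisimilar A τ x y ∧ SemiBisimilar A τ y z, ⟨?_, ?_⟩, u, hsu, hut⟩
  · rintro x z ⟨y, hxy, hyz⟩
    exact ⟨y, hyz.symm, hxy.symm⟩
  · rintro x z ⟨y, hxy, hyz⟩ a x' hx
    obtain ⟨y', hy', hxy', h⟩ := hB.2 x y hxy a x' hx
    obtain ⟨z', hz', hyz'⟩ := hB.exists_tauReach hyz hy'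
    obtain ⟨ha, h⟩ | ⟨y'', hy'', h⟩ := h
    · exact ⟨z', hz', ⟨y', hxy', hyz'⟩, Or.inl ⟨ha, y', h, hyz'⟩⟩
    · obtain ⟨w, hw, hyw, ⟨ha, h'⟩ | ⟨w', hw', h'⟩⟩ := hB.2 y' z' hyz' a y'' hy''
      · exact ⟨w, hz'.trans hw, ⟨y', hxy', hyw⟩, Or.inl ⟨ha, y'', h, h'⟩⟩
      · exact ⟨w, hz'.trans hw, ⟨y', hxy', hyw⟩, Or.inr ⟨w', hw', y'', h, h'⟩⟩

/-- The stuttering property of semi-branching bisimilarity. -/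
theorem SemiBisimilar.stutter {A : LTS S Act} {τ : Act} {t u v : S}
    (htu : TauReach A τ t u) (huv : TauReach A τ u v) (htv : SemiBisimilar A τ t v) :
    SemiBisimilar A τ t u := by
  have hB := isSemiBisim_semiBisimilar A τ
  refine ⟨fun x y => SemiBisimilar A τ x y ∨ (x = t ∧ y = u) ∨ (x = u ∧ y = t), ⟨?_, ?_⟩,
    Or.inr (Or.inl ⟨rfl, rfl⟩)⟩
  · rintro x y (h | h | h)
    · exact Or.inl h.symm
    · exact Or.inr (Or.inr h.symm)
    · exact Or.inr (Or.inl h.symm)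
  · rintro x y (h | ⟨rfl, rfl⟩ | ⟨rfl, rfl⟩)
    · exact (hB.2 x y h).mono fun _ _ => Or.inl
    · refine SemiTransfer.mono (R := SemiBisimilar A τ) ?_ fun _ _ => Or.inl
      intro a x' hx
      obtain ⟨w, hw, h⟩ := hB.2 _ _ htv a x' hx
      exact ⟨w, huv.trans hw, h⟩
    · intro a x' hx
      exact ⟨x, htu, Or.inl (.refl A τ x), Or.inr ⟨x', hx, Or.inl (.refl A τ x')⟩⟩

theorem tauReach_iff_exists_path {A : LTS S Act} {τ : Act} {s t : S} :
    TauReach A τ s t ↔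
      ∃ (k : ℕ) (f : ℕ → S), f 0 = s ∧ (∀ i < k, A.tr (f i) τ (f (i + 1))) ∧ f k = t := by
  constructor
  · intro h
    induction h using Relation.ReflTransGen.head_induction_on with
    | refl => exact ⟨0, fun _ => t, rfl, by simp, rfl⟩
    | @head a c hstep _ ih =>
      obtain ⟨k, f, rfl, hf, hk⟩ := ih
      refine ⟨k + 1, fun i => Nat.casesOn i a f, rfl, ?_, hk⟩
      rintro (_ | i) hi
      · exact hstep
      · exact hf i (by omega)
  · rintro ⟨k, f, rfl, hf, rfl⟩
    induction k with
    | zero => exact .refl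
    | succ k ih => exact (ih fun i hi => hf i (by omega)).tail (hf k (by omega))

theorem IsBranchingBisim.isSemiBisim {A : LTS S Act} {τ : Act} {R : S → S → Prop}
    (hR : IsBranchingBisim A τ R) : IsSemiBisim A τ R := by
  refine ⟨fun _ _ h => hR.1 h, fun s t h a s' hs => ?_⟩
  obtain ⟨ha, h'⟩ | ⟨k, f, h0, hf, hk, h'⟩ := hR.2 s t h a s' hs
  · exact ⟨t, .refl, h, Or.inl ⟨ha, h'⟩⟩
  · exact ⟨f k, tauReach_iff_exists_path.2 ⟨k, f, h0, hf, rfl⟩, hk, Or.inr h'⟩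

theorem isBranchingBisim_semiBisimilar (A : LTS S Act) (τ : Act) :
    IsBranchingBisim A τ (SemiBisimilar A τ) := by
  have hB := isSemiBisim_semiBisimilar A τ
  refine ⟨fun _ _ h => h.symm, fun s t h a s' hs => ?_⟩
  obtain ⟨t', ht', hst', ⟨rfl, h'⟩ | ⟨t'', htr, h'⟩⟩ := hB.2 s t h a s' hs
  · rcases ht'.cases_tail with rfl | ⟨u, htu, hut⟩
    · exact Or.inl ⟨rfl, h'⟩
    · have hsu : SemiBisimilar A a s u := h.trans (.stutter htu (.single hut) (h.symm.trans hst'))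
      obtain ⟨k, f, h0, hf, rfl⟩ := tauReach_iff_exists_path.1 htu
      exact Or.inr ⟨k, f, h0, hf, hsu, t', hut, h'⟩
  · obtain ⟨k, f, h0, hf, rfl⟩ := tauReach_iff_exists_path.1 ht'
    exact Or.inr ⟨k, f, h0, hf, hst', t'', htr, h'⟩

theorem branchingBisimilar_iff_semiBisimilar {A : LTS S Act} {τ : Act} {s t : S} :
    BranchingBisimilar A τ s t ↔ SemiBisimilar A τ s t :=
  ⟨fun ⟨R, hR, h⟩ => ⟨R, hR.isSemiBisim, h⟩,
    fun h => ⟨_, isBranchingBisim_semiBisimilar A τ, h⟩⟩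

/-- Branching bisimilarity is an equivalence relation. -/
theorem branching_bisimilar_equivalence [Fintype S] [Fintype Act]
    (A : LTS S Act) (τ : Act) :
    Equivalence (BranchingBisimilar A τ) := by
  have h : BranchingBisimilar A τ = SemiBisimilar A τ :=
    funext₂ fun _ _ => propext branchingBisimilar_iff_semiBisimilar
  rw [h]
  exact ⟨.refl A τ, .symm, .trans⟩
end

section
/- Let K=(S,AP,→,L) be a Kripke structure and π a partition of S that is stable, refines the initial partition π₀, and respects divergence-blind stuttering equivalence. Then π coincides with divergence-blind stuttering equivalence: for all s,t ∈ S, s and t lie in the same block of π if and only if s ≈_dbs t. -/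
variable {S AP : Type*}

/-- Lying in a common block of a stable partition whose blocks have constant labels is a
divergence-blind stuttering equivalence. -/
theorem isDBS_of_stable (K : Kripke S AP) (π : Set (Set S)) (hcover : ⋃₀ π = Set.univ)
    (hstable : ∀ B ∈ π, ∀ C ∈ π, ¬ Unstable K C B)
    (hrefine : ∀ B ∈ π, ∀ s ∈ B, ∀ t ∈ B, K.L s = K.L t) :
    IsDBS K (fun s t => ∃ B ∈ π, s ∈ B ∧ t ∈ B) := by
  refine ⟨fun s t ⟨B, hB, hs, ht⟩ => ⟨B, hB, ht, hs⟩, ?_⟩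
  rintro s t ⟨C, hC, hs, ht⟩
  refine ⟨hrefine C hC s hs t ht, fun s' hss' => ?_⟩
  obtain ⟨B, hB, hs'⟩ : s' ∈ ⋃₀ π := hcover ▸ Set.mem_univ s'
  have hsplit : s ∈ split K C B := by
    refine ⟨hs, 1, fun i => if i = 0 then s else s', ?_, ?_, ?_, ?_⟩ <;> simp [hss', hs, hs']
  have htsplit : t ∈ split K C B := by
    by_contra h
    exact hstable B hB C hC ⟨⟨s, hsplit⟩, ⟨t, ht, h⟩⟩
  obtain ⟨-, k, f, hf0, hstep, hmem, hend⟩ := htsplit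
  exact ⟨k, f, hf0, hstep, fun i hi => ⟨C, hC, hs, hmem i hi⟩, ⟨B, hB, hs', hend⟩⟩

/-- A stable partition refining the initial partition (states in a common
block have equal labels) and respecting divergence-blind stuttering
equivalence coincides with it: two states are in the same block iff they are
divergence-blind stuttering equivalent. -/
theorem stable_partition_coincides_dbs [Fintype S] [Fintype AP]
    (K : Kripke S AP) (π : Set (Set S))
    (hpart : IsPartition π)
    (hstable : ∀ σ ⊆ π, ∀ B' ∈ π, ¬ Unstable K B' (⋃₀ σ))
    (hrefine : ∀ B ∈ π, ∀ s ∈ B, ∀ t ∈ B, K.L s = K.L t)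
    (hresp : Respects K π) :
    ∀ s t : S, (∃ B ∈ π, s ∈ B ∧ t ∈ B) ↔ DBSEq K s t := by
  intro s t
  refine ⟨fun h => ⟨_, isDBS_of_stable K π hpart.2.2 (fun B hB C hC => ?_) hrefine, h⟩, hresp s t⟩
  simpa using hstable {B} (Set.singleton_subset_iff.mpr hB) C hC
end
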